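/- The function h(t) = log(Φ(t)/(1 − Φ(t))) is twice differentiable on ℝ with h′(t) = φ(t)/(Φ(t)(1 − Φ(t))) > 0, and its second derivative satisfies |h″(t)| ≤ 1 for every t ∈ ℝ. -/

import Mathlib

/-- The density `φ` of the standard normal distribution `N(0,1)`. -/
noncomputable def stdGaussPDF (t : ℝ) : ℝ := (Real.sqrt (2 * Real.pi))⁻¹ * Real.exp (-t ^ 2 / 2)

/-- The cumulative distribution function `Φ` of the standard normal distribution `N(0,1)`. -/
noncomputable def stdGaussCDF (t : ℝ) : ℝ := ∫ x in Set.Iic t, stdGaussPDF x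

/-- The probit log-odds function `h(t) = log(Φ(t)/(1 − Φ(t)))`. -/
noncomputable def probitLogOdds (t : ℝ) : ℝ :=
  Real.log (stdGaussCDF t / (1 - stdGaussCDF t))

open Filter Topology

lemma stdGaussPDF_eq_gaussianPDFReal : stdGaussPDF = ProbabilityTheory.gaussianPDFReal 0 1 := by
  ext t
  simp [stdGaussPDF, ProbabilityTheory.gaussianPDFReal]

lemma stdGaussPDF_pos (t : ℝ) : 0 < stdGaussPDF t := by
  unfold stdGaussPDF
  positivity

lemma continuous_stdGaussPDF : Continuous stdGaussPDF := by
  unfold stdGaussPDF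
  fun_prop

lemma hasDerivAt_stdGaussPDF (t : ℝ) : HasDerivAt stdGaussPDF (-t * stdGaussPDF t) t := by
  have h : HasDerivAt (fun x : ℝ => -x ^ 2 / 2) (-t) t := by
    refine ((hasDerivAt_pow 2 t).neg.div_const 2).congr_deriv ?_
    norm_num
    ring
  refine (h.exp.const_mul (Real.sqrt (2 * Real.pi))⁻¹).congr_deriv ?_
  unfold stdGaussPDF
  ring

lemma integrable_stdGaussPDF : MeasureTheory.Integrable stdGaussPDF := by
  rw [stdGaussPDF_eq_gaussianPDFReal]
  exact ProbabilityTheory.integrable_gaussianPDFReal 0 1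

lemma hasDerivAt_stdGaussCDF (t : ℝ) : HasDerivAt stdGaussCDF (stdGaussPDF t) t := by
  have h : stdGaussCDF = fun u => stdGaussCDF 0 + ∫ x in (0 : ℝ)..u, stdGaussPDF x := by
    ext u
    rw [← intervalIntegral.integral_Iic_sub_Iic integrable_stdGaussPDF.integrableOn
      integrable_stdGaussPDF.integrableOn]
    simp [stdGaussCDF]
  rw [h]
  exact (intervalIntegral.integral_hasDerivAt_right
    (continuous_stdGaussPDF.intervalIntegrable _ _)
    continuous_stdGaussPDF.stronglyMeasurable.stronglyMeasurableAtFilter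
    continuous_stdGaussPDF.continuousAt).const_add _

lemma stdGaussCDF_eq_cdf :
    stdGaussCDF = ProbabilityTheory.cdf (ProbabilityTheory.gaussianReal 0 1) := by
  ext t
  rw [ProbabilityTheory.cdf_eq_real, MeasureTheory.measureReal_def,
    ProbabilityTheory.gaussianReal_apply_eq_integral _ one_ne_zero,
    ENNReal.toReal_ofReal
      (MeasureTheory.integral_nonneg fun x => ProbabilityTheory.gaussianPDFReal_nonneg 0 1 x),
    stdGaussCDF, stdGaussPDF_eq_gaussianPDFReal]

lemma tendsto_stdGaussCDF_atTop : Tendsto stdGaussCDF atTop (𝓝 1) := by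
  rw [stdGaussCDF_eq_cdf]
  exact ProbabilityTheory.tendsto_cdf_atTop _

lemma tendsto_stdGaussCDF_atBot : Tendsto stdGaussCDF atBot (𝓝 0) := by
  rw [stdGaussCDF_eq_cdf]
  exact ProbabilityTheory.tendsto_cdf_atBot _

lemma strictMono_stdGaussCDF : StrictMono stdGaussCDF :=
  strictMono_of_hasDerivAt_pos hasDerivAt_stdGaussCDF stdGaussPDF_pos

lemma stdGaussCDF_pos (t : ℝ) : 0 < stdGaussCDF t :=
  (strictMono_stdGaussCDF.monotone.le_of_tendsto tendsto_stdGaussCDF_atBot (t - 1)).trans_lt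
    (strictMono_stdGaussCDF (sub_one_lt t))

lemma stdGaussCDF_lt_one (t : ℝ) : stdGaussCDF t < 1 :=
  (strictMono_stdGaussCDF (lt_add_one t)).trans_le
    (strictMono_stdGaussCDF.monotone.ge_of_tendsto tendsto_stdGaussCDF_atTop (t + 1))

lemma tendsto_stdGaussPDF_cocompact : Tendsto stdGaussPDF (cocompact ℝ) (𝓝 0) := by
  have h := (tendsto_rpow_abs_mul_exp_neg_mul_sq_cocompact (a := 1 / 2) (by norm_num) 0).const_mul
    (Real.sqrt (2 * Real.pi))⁻¹
  rw [mul_zero] at h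
  refine h.congr fun x => ?_
  rw [Real.rpow_zero, one_mul, stdGaussPDF]
  ring_nf

lemma tendsto_mul_stdGaussPDF_cocompact :
    Tendsto (fun x => x * stdGaussPDF x) (cocompact ℝ) (𝓝 0) := by
  rw [tendsto_zero_iff_abs_tendsto_zero]
  have h := (tendsto_rpow_abs_mul_exp_neg_mul_sq_cocompact (a := 1 / 2) (by norm_num) 1).const_mul
    (Real.sqrt (2 * Real.pi))⁻¹
  rw [mul_zero] at h
  refine h.congr fun x => ?_
  rw [Function.comp_apply, abs_mul, abs_of_pos (stdGaussPDF_pos x), Real.rpow_one, stdGaussPDF]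
  ring_nf

/-- An antiderivative of `(x - m) ^ 2 * φ x`. -/
noncomputable def gaussSqPrimitive (m x : ℝ) : ℝ :=
  (1 + m ^ 2) * stdGaussCDF x + 2 * m * stdGaussPDF x - x * stdGaussPDF x

lemma monotone_gaussSqPrimitive (m : ℝ) : Monotone (gaussSqPrimitive m) := by
  refine monotone_of_hasDerivAt_nonneg (f' := fun x => (x - m) ^ 2 * stdGaussPDF x)
    (fun x => ?_) fun x => mul_nonneg (sq_nonneg _) (stdGaussPDF_pos x).le
  refine ((((hasDerivAt_stdGaussCDF x).const_mul (1 + m ^ 2)).add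
    ((hasDerivAt_stdGaussPDF x).const_mul (2 * m))).sub
    ((hasDerivAt_id x).mul (hasDerivAt_stdGaussPDF x))).congr_deriv ?_
  simp only [id]
  ring

lemma tendsto_gaussSqPrimitive {l : Filter ℝ} (hl : l ≤ cocompact ℝ) {c : ℝ}
    (hc : Tendsto stdGaussCDF l (𝓝 c)) (m : ℝ) :
    Tendsto (gaussSqPrimitive m) l (𝓝 ((1 + m ^ 2) * c)) := by
  unfold gaussSqPrimitive
  simpa using ((hc.const_mul (1 + m ^ 2)).add
    ((tendsto_stdGaussPDF_cocompact.mono_left hl).const_mul (2 * m))).sub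
    (tendsto_mul_stdGaussPDF_cocompact.mono_left hl)

lemma gaussSqPrimitive_nonneg (m t : ℝ) : 0 ≤ gaussSqPrimitive m t := by
  simpa using (monotone_gaussSqPrimitive m).le_of_tendsto
    (tendsto_gaussSqPrimitive atBot_le_cocompact tendsto_stdGaussCDF_atBot m) t

lemma gaussSqPrimitive_le (m t : ℝ) : gaussSqPrimitive m t ≤ 1 + m ^ 2 := by
  simpa using (monotone_gaussSqPrimitive m).ge_of_tendsto
    (tendsto_gaussSqPrimitive atTop_le_cocompact tendsto_stdGaussCDF_atTop m) t

lemma hasDerivAt_pdf_add_const_mul_cdf (t x : ℝ) :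
    HasDerivAt (fun y => stdGaussPDF y + t * stdGaussCDF y) ((t - x) * stdGaussPDF x) x := by
  refine ((hasDerivAt_stdGaussPDF x).add
    ((hasDerivAt_stdGaussCDF x).const_mul t)).congr_deriv ?_
  ring

lemma tendsto_pdf_add_const_mul_cdf {l : Filter ℝ} (hl : l ≤ cocompact ℝ) {c : ℝ}
    (hc : Tendsto stdGaussCDF l (𝓝 c)) (t : ℝ) :
    Tendsto (fun y => stdGaussPDF y + t * stdGaussCDF y) l (𝓝 (t * c)) := by
  simpa using (tendsto_stdGaussPDF_cocompact.mono_left hl).add (hc.const_mul t)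

/-- The first-order Mills ratio bound on the left tail. -/
lemma stdGaussPDF_add_mul_cdf_nonneg (t : ℝ) : 0 ≤ stdGaussPDF t + t * stdGaussCDF t := by
  have hmono : MonotoneOn (fun y => stdGaussPDF y + t * stdGaussCDF y) (Set.Iic t) := by
    refine monotoneOn_of_deriv_nonneg (convex_Iic t)
      (fun x _ => (hasDerivAt_pdf_add_const_mul_cdf t x).continuousAt.continuousWithinAt)
      (fun x _ => (hasDerivAt_pdf_add_const_mul_cdf t x).differentiableAt.differentiableWithinAt)
      fun x hx => ?_
    rw [(hasDerivAt_pdf_add_const_mul_cdf t x).deriv]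
    rw [interior_Iic] at hx
    exact mul_nonneg (sub_nonneg.2 (le_of_lt hx)) (stdGaussPDF_pos x).le
  have hlim := tendsto_pdf_add_const_mul_cdf atBot_le_cocompact tendsto_stdGaussCDF_atBot t
  rw [mul_zero] at hlim
  refine le_of_tendsto hlim ?_
  filter_upwards [eventually_le_atBot t] with x hx
  exact hmono hx Set.self_mem_Iic hx

/-- The first-order Mills ratio bound on the right tail. -/
lemma mul_one_sub_cdf_le_stdGaussPDF (t : ℝ) : t * (1 - stdGaussCDF t) ≤ stdGaussPDF t := by
  have hanti : AntitoneOn (fun y => stdGaussPDF y + t * stdGaussCDF y) (Set.Ici t) := by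
    refine antitoneOn_of_deriv_nonpos (convex_Ici t)
      (fun x _ => (hasDerivAt_pdf_add_const_mul_cdf t x).continuousAt.continuousWithinAt)
      (fun x _ => (hasDerivAt_pdf_add_const_mul_cdf t x).differentiableAt.differentiableWithinAt)
      fun x hx => ?_
    rw [(hasDerivAt_pdf_add_const_mul_cdf t x).deriv]
    rw [interior_Ici] at hx
    exact mul_nonpos_of_nonpos_of_nonneg (sub_nonpos.2 (le_of_lt hx)) (stdGaussPDF_pos x).le
  have hlim := tendsto_pdf_add_const_mul_cdf atTop_le_cocompact tendsto_stdGaussCDF_atTop t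
  have h : t * 1 ≤ stdGaussPDF t + t * stdGaussCDF t := by
    refine le_of_tendsto hlim ?_
    filter_upwards [eventually_ge_atTop t] with x hx
    exact hanti Set.self_mem_Ici hx hx
  linarith

/-- The derivative `m (m - t)` of the hazard rate `m = φ / (1 - Φ)` lies in `[0, 1]`. -/
lemma hazard_deriv_mem_Icc (t : ℝ) :
    stdGaussPDF t / (1 - stdGaussCDF t) * (stdGaussPDF t / (1 - stdGaussCDF t) - t) ∈
      Set.Icc (0 : ℝ) 1 := by
  have hQ : 0 < 1 - stdGaussCDF t := sub_pos.2 (stdGaussCDF_lt_one t)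
  set m := stdGaussPDF t / (1 - stdGaussCDF t) with hm
  have hmQ : stdGaussPDF t = m * (1 - stdGaussCDF t) := by rw [hm]; field_simp
  have hm0 : 0 < m := div_pos (stdGaussPDF_pos t) hQ
  constructor
  · exact mul_nonneg hm0.le
      (sub_nonneg.2 ((le_div_iff₀ hQ).2 (mul_one_sub_cdf_le_stdGaussPDF t)))
  · have h := gaussSqPrimitive_le m t
    rw [gaussSqPrimitive, hmQ] at h
    have h' : 0 ≤ (1 - m * (m - t)) * (1 - stdGaussCDF t) := by linarith
    linarith [nonneg_of_mul_nonneg_left h' hQ]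

/-- The negated derivative `r (r + t)` of `r = φ / Φ` lies in `[0, 1]`. -/
lemma reversed_hazard_neg_deriv_mem_Icc (t : ℝ) :
    stdGaussPDF t / stdGaussCDF t * (stdGaussPDF t / stdGaussCDF t + t) ∈ Set.Icc (0 : ℝ) 1 := by
  have hP := stdGaussCDF_pos t
  set r := stdGaussPDF t / stdGaussCDF t with hr
  have hrP : stdGaussPDF t = r * stdGaussCDF t := by rw [hr]; field_simp
  have hr0 : 0 < r := div_pos (stdGaussPDF_pos t) hP
  constructor
  · have h := stdGaussPDF_add_mul_cdf_nonneg t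
    rw [hrP, ← add_mul] at h
    exact mul_nonneg hr0.le (nonneg_of_mul_nonneg_left h hP)
  · have h := gaussSqPrimitive_nonneg (-r) t
    rw [gaussSqPrimitive, hrP] at h
    have h' : 0 ≤ (1 - r * (r + t)) * stdGaussCDF t := by linarith
    linarith [nonneg_of_mul_nonneg_left h' hP]

lemma hasDerivAt_probitLogOdds (t : ℝ) : HasDerivAt probitLogOdds
    (stdGaussPDF t / (stdGaussCDF t * (1 - stdGaussCDF t))) t := by
  have hP := (stdGaussCDF_pos t).ne'
  have hQ := (sub_pos.2 (stdGaussCDF_lt_one t)).ne'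
  have hd := hasDerivAt_stdGaussCDF t
  refine ((hd.div (hd.const_sub 1) hQ).log (div_ne_zero hP hQ)).congr_deriv ?_
  simp only [Pi.div_apply]
  field_simp
  ring

lemma hasDerivAt_deriv_probitLogOdds (t : ℝ) : HasDerivAt (deriv probitLogOdds)
    (stdGaussPDF t / (1 - stdGaussCDF t) * (stdGaussPDF t / (1 - stdGaussCDF t) - t) -
      stdGaussPDF t / stdGaussCDF t * (stdGaussPDF t / stdGaussCDF t + t)) t := by
  have hP := (stdGaussCDF_pos t).ne'
  have hQ := (sub_pos.2 (stdGaussCDF_lt_one t)).ne'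
  have hd := hasDerivAt_stdGaussCDF t
  have heq : deriv probitLogOdds =
      fun x => stdGaussPDF x / (stdGaussCDF x * (1 - stdGaussCDF x)) :=
    funext fun x => (hasDerivAt_probitLogOdds x).deriv
  rw [heq]
  refine ((hasDerivAt_stdGaussPDF t).div (hd.mul (hd.const_sub 1))
    (mul_ne_zero hP hQ)).congr_deriv ?_
  simp only [Pi.mul_apply]
  field_simp
  ring

/-- `h(t) = log(Φ(t)/(1 − Φ(t)))` is twice differentiable on `ℝ` with
`h′(t) = φ(t)/(Φ(t)(1 − Φ(t))) > 0` and `|h″(t)| ≤ 1` for every `t ∈ ℝ`. -/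
theorem probitLogOdds_deriv_and_bounds :
    (∀ t : ℝ, HasDerivAt probitLogOdds
        (stdGaussPDF t / (stdGaussCDF t * (1 - stdGaussCDF t))) t) ∧
    (∀ t : ℝ, 0 < stdGaussPDF t / (stdGaussCDF t * (1 - stdGaussCDF t))) ∧
    (∀ t : ℝ, DifferentiableAt ℝ (deriv probitLogOdds) t) ∧
    (∀ t : ℝ, |deriv (deriv probitLogOdds) t| ≤ 1) := by
  refine ⟨hasDerivAt_probitLogOdds, fun t => ?_,
    fun t => (hasDerivAt_deriv_probitLogOdds t).differentiableAt, fun t => ?_⟩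
  · exact div_pos (stdGaussPDF_pos t)
      (mul_pos (stdGaussCDF_pos t) (sub_pos.2 (stdGaussCDF_lt_one t)))
  · rw [(hasDerivAt_deriv_probitLogOdds t).deriv, abs_le]
    obtain ⟨h₁, h₂⟩ := hazard_deriv_mem_Icc t
    obtain ⟨h₃, h₄⟩ := reversed_hazard_neg_deriv_mem_Icc t
    constructor <;> linarith
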